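/- Let a, b ≥ 0 with a + b > 0 and h > 0 be reals, and define E : [0,∞) → ℝ by E(ε) = cosh ε·cosh(a+b) + sinh ε·cosh h·sinh(a+b) + sinh²h·sinh²(ε/2)·(cosh(a+b) − cosh(a−b)). Then E is continuous and strictly increasing, E(0) = cosh(a+b), and E(ε) → ∞ as ε → ∞. Consequently x(ε) := arcosh(E(ε)) increases continuously and without bound with ε, and x(ε) → a + b as ε → 0. -/

import Mathlib

open Real Filter

/-- The real inverse hyperbolic cosine (for `x ≥ 1`). -/
noncomputable def arcosh (x : ℝ) : ℝ := Real.log (x + Real.sqrt (x ^ 2 - 1))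

theorem stmt_16 (a b h : ℝ) (ha : 0 ≤ a) (hb : 0 ≤ b) (hab : 0 < a + b)
    (hh : 0 < h) (E : ℝ → ℝ)
    (hE : ∀ ε : ℝ, E ε = Real.cosh ε * Real.cosh (a + b)
        + Real.sinh ε * Real.cosh h * Real.sinh (a + b)
        + Real.sinh h ^ 2 * Real.sinh (ε / 2) ^ 2
            * (Real.cosh (a + b) - Real.cosh (a - b))) :
    ContinuousOn E (Set.Ici 0) ∧
    StrictMonoOn E (Set.Ici 0) ∧
    E 0 = Real.cosh (a + b) ∧
    Tendsto E atTop atTop ∧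
    ContinuousOn (fun ε => _root_.arcosh (E ε)) (Set.Ici 0) ∧
    StrictMonoOn (fun ε => _root_.arcosh (E ε)) (Set.Ici 0) ∧
    Tendsto (fun ε => _root_.arcosh (E ε)) atTop atTop ∧
    Tendsto (fun ε => _root_.arcosh (E ε)) (nhdsWithin 0 (Set.Ici 0)) (nhds (a + b)) := by
  have hEq : _root_.arcosh = Real.arcosh := rfl
  have hcont : Continuous E := by
    have : E = fun ε => Real.cosh ε * Real.cosh (a + b)
        + Real.sinh ε * Real.cosh h * Real.sinh (a + b)
        + Real.sinh h ^ 2 * Real.sinh (ε / 2) ^ 2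
            * (Real.cosh (a + b) - Real.cosh (a - b)) := funext hE
    rw [this]
    have h1 := Real.continuous_sinh
    have h2 := Real.continuous_cosh
    fun_prop
  have hs : 0 < Real.sinh (a + b) := Real.sinh_pos_iff.2 hab
  have hc : 1 ≤ Real.cosh (a + b) := Real.one_le_cosh _
  have hd : 0 ≤ Real.cosh (a + b) - Real.cosh (a - b) := by
    rw [sub_nonneg, Real.cosh_le_cosh, abs_of_pos hab, abs_le]
    constructor <;> linarith
  have hmono : StrictMonoOn E (Set.Ici 0) := by
    intro x hx y hy hxy
    simp only [Set.mem_Ici] at hx hy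
    rw [hE, hE]
    have h1 : Real.cosh x < Real.cosh y := by
      rw [Real.cosh_lt_cosh, abs_of_nonneg hx, abs_of_nonneg hy]; exact hxy
    have h2 : Real.sinh x ≤ Real.sinh y := Real.sinh_le_sinh.2 hxy.le
    have h3 : Real.sinh (x / 2) ≤ Real.sinh (y / 2) := Real.sinh_le_sinh.2 (by linarith)
    have h4 : 0 ≤ Real.sinh (x / 2) := Real.sinh_nonneg_iff.2 (by linarith)
    have h5 : 0 < Real.cosh h := Real.cosh_pos h
    have e1 : Real.cosh x * Real.cosh (a + b) < Real.cosh y * Real.cosh (a + b) :=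
      mul_lt_mul_of_pos_right h1 (by linarith)
    have e2 : Real.sinh x * Real.cosh h * Real.sinh (a + b)
        ≤ Real.sinh y * Real.cosh h * Real.sinh (a + b) := by gcongr
    have e3 : Real.sinh h ^ 2 * Real.sinh (x / 2) ^ 2 * (Real.cosh (a + b) - Real.cosh (a - b))
        ≤ Real.sinh h ^ 2 * Real.sinh (y / 2) ^ 2
          * (Real.cosh (a + b) - Real.cosh (a - b)) := by gcongr
    linarith
  have h0 : E 0 = Real.cosh (a + b) := by simp [hE]
  have hge : ∀ x ∈ Set.Ici (0 : ℝ), 1 ≤ E x := by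
    intro x hx
    have := hmono.monotoneOn (Set.mem_Ici.2 le_rfl) hx hx
    linarith
  have htop : Tendsto E atTop atTop := by
    refine tendsto_atTop_mono' _ ?_ tendsto_id
    filter_upwards [eventually_ge_atTop 0] with x hx
    rw [hE, id]
    have h1 : x ≤ Real.sinh x := Real.self_le_sinh_iff.2 hx
    have h2 : Real.sinh x < Real.cosh x := Real.sinh_lt_cosh x
    have h3 : 0 < Real.cosh h := Real.cosh_pos h
    have h4 : 0 ≤ Real.sinh x := by linarith
    have e1 : Real.cosh x ≤ Real.cosh x * Real.cosh (a + b) :=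
      le_mul_of_one_le_right (Real.cosh_pos x).le hc
    have e2 : 0 ≤ Real.sinh x * Real.cosh h * Real.sinh (a + b) := by positivity
    have e3 : 0 ≤ Real.sinh h ^ 2 * Real.sinh (x / 2) ^ 2
        * (Real.cosh (a + b) - Real.cosh (a - b)) := mul_nonneg (by positivity) hd
    linarith
  have hac : ContinuousOn (fun ε => _root_.arcosh (E ε)) (Set.Ici 0) := by
    rw [hEq]
    exact Real.continuousOn_arcosh.comp hcont.continuousOn hge
  refine ⟨hcont.continuousOn, hmono, h0, htop, hac, ?_, ?_, ?_⟩
  · rw [hEq]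
    intro x hx y hy hxy
    have h1 := hge x hx
    have h2 := hge y hy
    exact (Real.arcosh_lt_arcosh (by linarith) (by linarith)).2 (hmono hx hy hxy)
  · refine tendsto_atTop_mono' _ ?_ (Real.tendsto_log_atTop.comp htop)
    filter_upwards [eventually_ge_atTop 0] with x hx
    have h1 := hge x hx
    exact Real.log_le_log (by linarith) (le_add_of_nonneg_right (Real.sqrt_nonneg _))
  · have h1 := hac 0 (Set.mem_Ici.2 le_rfl)
    have h2 : _root_.arcosh (E 0) = a + b := by
      rw [h0, hEq, Real.arcosh_cosh hab.le]
    rw [ContinuousWithinAt, h2] at h1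
    exact h1
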